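/- Let m ≥ 1, let μ be a probability distribution on F_2^m, and for each power of two n = 2^k let X be an m×n random matrix with i.i.d. columns distributed according to μ, and let Y = X·G_n over F_2. Then for every ε > 0, (1/n)·|{ j ∈ {1,…,n} : for every S ⊆ {1,…,m}, H(Y_j[S] | Y_1,…,Y_{j-1}) lies within ε of some integer in {0,1,…,|S|} }| converges to 1 as k → ∞. -/

import Mathlib

open MeasureTheory ProbabilityTheory Filter
open scoped Classical

/-- Shannon entropy (in bits) of a finite-valued random variable `X` on `(Ω, μ)`:
`H(X) = ∑ₓ P(X = x) log₂ (1 / P(X = x))`. -/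
noncomputable def shEnt {Ω : Type*} [MeasurableSpace Ω] (μ : Measure Ω)
    {α : Type*} [Fintype α] (X : Ω → α) : ℝ :=
  (∑ x : α, Real.negMulLog ((μ (X ⁻¹' {x})).toReal)) / Real.log 2

/-- Conditional Shannon entropy (in bits) of discrete random variables:
`H(X | Y) = H(X, Y) - H(Y)`. -/
noncomputable def cEnt {Ω : Type*} [MeasurableSpace Ω] (μ : Measure Ω)
    {α β : Type*} [Fintype α] [Fintype β] (X : Ω → α) (Y : Ω → β) : ℝ :=
  shEnt μ (fun ω => (X ω, Y ω)) - shEnt μ Y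

/-- Shannon entropy (in bits) of a distribution on a finite set. -/
noncomputable def distEnt {α : Type*} [MeasurableSpace α] [Fintype α] (ν : Measure α) : ℝ :=
  (∑ x : α, Real.negMulLog ((ν {x}).toReal)) / Real.log 2

/-- The binary entropy function `h(p) = -p log₂ p - (1-p) log₂ (1-p)`. -/
noncomputable def binEnt (p : ℝ) : ℝ :=
  (Real.negMulLog p + Real.negMulLog (1 - p)) / Real.log 2

/-- The Bernoulli(p) distribution on `F₂` (probability `p` of the outcome `1`). -/
noncomputable def bern (p : ℝ) : Measure (ZMod 2) :=
  ENNReal.ofReal (1 - p) • Measure.dirac 0 + ENNReal.ofReal p • Measure.dirac 1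

/-- `G k` is the `2^k × 2^k` matrix over `F₂` given by the `k`-fold Kronecker power of
`[[1,0],[1,1]]`, in closed form: the `(i,j)` entry is `1` iff each binary digit of `j`
is dominated by the corresponding binary digit of `i` (for the single factor
`[[1,0],[1,1]]`, the `(a,b)` entry is `1` iff the bit `b` is dominated by the bit `a`,
and the Kronecker power multiplies these bitwise conditions). -/
def G (k : ℕ) : Matrix (Fin (2 ^ k)) (Fin (2 ^ k)) (ZMod 2) :=
  Matrix.of fun i j => if j.val &&& i.val = j.val then 1 else 0

/-- The total weight of the fibre of `f` over `a`. -/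
noncomputable def mass {Ω : Type*} [Fintype Ω] (w : Ω → ℝ) {α : Type*} (f : Ω → α) (a : α) : ℝ :=
  ∑ x, if f x = a then w x else 0

/-- The entropy (in nats) of `f` under the weights `w`. -/
noncomputable def wEnt {Ω : Type*} [Fintype Ω] (w : Ω → ℝ) {α : Type*} (f : Ω → α) : ℝ :=
  ∑ x, w x * -Real.log (mass w f (f x))

section weights
variable {Ω Ω' : Type*} [Fintype Ω] [Fintype Ω'] {α β γ : Type*}

lemma wEnt_congr (w : Ω → ℝ) {f : Ω → α} {g : Ω → β}
    (h : ∀ x y, f x = f y ↔ g x = g y) : wEnt w f = wEnt w g := by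
  unfold wEnt mass
  simp only [h]

lemma wEnt_equiv (e : Ω' ≃ Ω) (w : Ω → ℝ) (f : Ω → α) :
    wEnt w f = wEnt (fun x => w (e x)) (fun x => f (e x)) := by
  unfold wEnt mass
  rw [← e.sum_comp]
  refine Finset.sum_congr rfl fun x _ => ?_
  rw [← e.sum_comp]

lemma mass_nonneg {w : Ω → ℝ} (hw : ∀ x, 0 ≤ w x) (f : Ω → α) (a : α) : 0 ≤ mass w f a :=
  Finset.sum_nonneg fun x _ => by split_ifs <;> simp [hw]

lemma le_mass {w : Ω → ℝ} (hw : ∀ x, 0 ≤ w x) (f : Ω → α) (x : Ω) : w x ≤ mass w f (f x) := by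
  have := Finset.single_le_sum (f := fun y => if f y = f x then w y else 0)
    (fun y _ => by split_ifs <;> simp [hw]) (Finset.mem_univ x)
  simpa [mass] using this

/-- Push-forward of a weighted sum. -/
lemma sum_mul_mass [Fintype α] (w : Ω → ℝ) (f : Ω → α) (φ : α → ℝ) :
    ∑ a, mass w f a * φ a = ∑ x, w x * φ (f x) := by
  simp only [mass, Finset.sum_mul]
  rw [Finset.sum_comm]
  refine Finset.sum_congr rfl fun x _ => ?_
  rw [Finset.sum_eq_single (f x)]
  · simp
  · intro b _ hb
    simp [hb.symm]
  · simp

lemma sum_mass [Fintype α] (w : Ω → ℝ) (f : Ω → α) : ∑ a, mass w f a = ∑ x, w x := by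
  simpa using sum_mul_mass w f (fun _ => 1)

lemma wEnt_eq_sum_negMulLog [Fintype α] (w : Ω → ℝ) (f : Ω → α) :
    wEnt w f = ∑ a, Real.negMulLog (mass w f a) := by
  have := sum_mul_mass w f (fun a => -Real.log (mass w f a))
  simp only [wEnt, Real.negMulLog]
  simp only [mul_neg, neg_mul] at *
  rw [this]

lemma sum_mass_pair [Fintype α] (w : Ω → ℝ) (f : Ω → α) (g : Ω → β) (b : β) :
    ∑ a, mass w (fun x => (f x, g x)) (a, b) = mass w g b := by
  simp only [mass, Prod.mk.injEq]
  rw [Finset.sum_comm]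
  refine Finset.sum_congr rfl fun x _ => ?_
  simp [ite_and]

/-- Strong subadditivity of entropy. -/
lemma wEnt_submodular [Fintype α] [Fintype β] [Fintype γ] {w : Ω → ℝ} (hw : ∀ x, 0 ≤ w x)
    (hw1 : ∑ x, w x = 1) (f : Ω → α) (g : Ω → β) (h : Ω → γ) :
    wEnt w (fun x => (f x, g x, h x)) + wEnt w h
      ≤ wEnt w (fun x => (f x, h x)) + wEnt w (fun x => (g x, h x)) := by
  set p := mass w (fun x => (f x, g x, h x)) with hp
  set p1 := mass w (fun x => (f x, h x)) with hp1
  set p2 := mass w (fun x => (g x, h x)) with hp2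
  set p3 := mass w h with hp3
  have key : ∀ x, w x - w x * ((p1 (f x, h x) * p2 (g x, h x)) / (p (f x, g x, h x) * p3 (h x)))
      ≤ w x * (-Real.log (p1 (f x, h x)) + -Real.log (p2 (g x, h x))
        - -Real.log (p (f x, g x, h x)) - -Real.log (p3 (h x))) := by
    intro x
    rcases (hw x).eq_or_lt with h0 | h0
    · simp [← h0]
    have a : 0 < p (f x, g x, h x) := h0.trans_le (le_mass hw (fun x => (f x, g x, h x)) x)
    have a1 : 0 < p1 (f x, h x) := h0.trans_le (le_mass hw (fun x => (f x, h x)) x)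
    have a2 : 0 < p2 (g x, h x) := h0.trans_le (le_mass hw (fun x => (g x, h x)) x)
    have a3 : 0 < p3 (h x) := h0.trans_le (le_mass hw h x)
    have := Real.log_le_sub_one_of_pos
      (x := (p1 (f x, h x) * p2 (g x, h x)) / (p (f x, g x, h x) * p3 (h x))) (by positivity)
    rw [Real.log_div (by positivity) (by positivity), Real.log_mul a1.ne' a2.ne',
      Real.log_mul a.ne' a3.ne'] at this
    nlinarith
  have hsum := Finset.sum_le_sum fun x (_ : x ∈ Finset.univ) => key x
  have hle : ∑ x, w x * ((p1 (f x, h x) * p2 (g x, h x)) / (p (f x, g x, h x) * p3 (h x))) ≤ 1 := by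
    rw [← sum_mul_mass w (fun x => (f x, g x, h x))
      (fun t => (p1 (t.1, t.2.2) * p2 (t.2.1, t.2.2)) / (p t * p3 t.2.2)), ← hp]
    calc ∑ t, p t * (p1 (t.1, t.2.2) * p2 (t.2.1, t.2.2) / (p t * p3 t.2.2))
        ≤ ∑ t : α × β × γ, p1 (t.1, t.2.2) * p2 (t.2.1, t.2.2) / p3 t.2.2 := by
          refine Finset.sum_le_sum fun t _ => ?_
          rcases eq_or_ne (p t) 0 with h0 | h0
          · rw [h0, zero_mul]
            exact div_nonneg (mul_nonneg (mass_nonneg hw _ _) (mass_nonneg hw _ _))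
              (mass_nonneg hw _ _)
          · rw [mul_div_mul_comm, ← mul_assoc, ← mul_div_assoc]
            apply le_of_eq
            field_simp
      _ = ∑ c, (∑ a, p1 (a, c)) * (∑ b, p2 (b, c)) / p3 c := by
          simp only [Fintype.sum_prod_type, Finset.sum_mul_sum, Finset.sum_div]
          exact (Finset.sum_congr rfl fun a _ => Finset.sum_comm).trans Finset.sum_comm
      _ = ∑ c, p3 c * p3 c / p3 c := by
          refine Finset.sum_congr rfl fun c _ => ?_
          rw [hp1, hp2, sum_mass_pair, sum_mass_pair]
      _ ≤ 1 := by
          simp only [mul_self_div_self]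
          rw [hp3, sum_mass, hw1]
  simp only [Finset.sum_sub_distrib, mul_sub, mul_add, Finset.sum_add_distrib, hw1] at hsum
  have t0 : wEnt w (fun x => (f x, g x, h x)) = ∑ x, w x * -Real.log (p (f x, g x, h x)) := rfl
  have t1 : wEnt w (fun x => (f x, h x)) = ∑ x, w x * -Real.log (p1 (f x, h x)) := rfl
  have t2 : wEnt w (fun x => (g x, h x)) = ∑ x, w x * -Real.log (p2 (g x, h x)) := rfl
  have t3 : wEnt w h = ∑ x, w x * -Real.log (p3 (h x)) := rfl
  linarith

lemma mass_prod (w : Ω → ℝ) (f : Ω → α) (a a' : α) :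
    mass (fun z : Ω × Ω => w z.1 * w z.2) (fun z => (f z.1, f z.2)) (a, a')
      = mass w f a * mass w f a' := by
  rw [mass, Fintype.sum_prod_type, mass, mass, Finset.sum_mul_sum]
  refine Finset.sum_congr rfl fun x _ => Finset.sum_congr rfl fun y _ => ?_
  by_cases h1 : f x = a <;> by_cases h2 : f y = a' <;> simp [h1, h2]

lemma wEnt_prod {w : Ω → ℝ} (hw : ∀ x, 0 ≤ w x) (hw1 : ∑ x, w x = 1) (f : Ω → α) :
    wEnt (fun z : Ω × Ω => w z.1 * w z.2) (fun z => (f z.1, f z.2)) = 2 * wEnt w f := by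
  have hz : ∀ z : Ω × Ω, w z.1 * w z.2 * -Real.log (mass w f (f z.1) * mass w f (f z.2))
      = (w z.1 * -Real.log (mass w f (f z.1))) * w z.2
        + w z.1 * (w z.2 * -Real.log (mass w f (f z.2))) := by
    intro z
    rcases (hw z.1).eq_or_lt with h0 | h0
    · simp [← h0]
    rcases (hw z.2).eq_or_lt with h0' | h0'
    · simp [← h0']
    rw [Real.log_mul (h0.trans_le (le_mass hw f _)).ne' (h0'.trans_le (le_mass hw f _)).ne']
    ring
  unfold wEnt
  simp only [mass_prod, hz]
  rw [Finset.sum_add_distrib, Fintype.sum_prod_type, Fintype.sum_prod_type]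
  simp only [← Finset.mul_sum, ← Finset.sum_mul, hw1]
  ring

end weights

/-- The entropy (in nats) of a vector of probabilities. -/
noncomputable def vecEnt {B : Type*} [Fintype B] (p : B → ℝ) : ℝ :=
  ∑ b, Real.negMulLog (p b)

section vecEnt
variable {B : Type*} [Fintype B]

lemma exists_ne_zero_of_mem_stdSimplex {p : B → ℝ} (hp : p ∈ stdSimplex ℝ B) : ∃ b, p b ≠ 0 := by
  by_contra! h
  have := hp.2
  simp [h] at this

lemma continuous_vecEnt : Continuous (vecEnt : (B → ℝ) → ℝ) := by
  unfold vecEnt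
  exact continuous_finsetSum _ fun b _ => Real.continuous_negMulLog.comp (continuous_apply b)

lemma vecEnt_nonneg {p : B → ℝ} (hp : p ∈ stdSimplex ℝ B) : 0 ≤ vecEnt p :=
  Finset.sum_nonneg fun b _ => Real.negMulLog_nonneg (hp.1 b)
    (hp.2 ▸ Finset.single_le_sum (fun c _ => hp.1 c) (Finset.mem_univ b))

lemma vecEnt_le_card {p : B → ℝ} (hp : p ∈ stdSimplex ℝ B) : vecEnt p ≤ Fintype.card B := by
  calc vecEnt p ≤ ∑ _b : B, (1 : ℝ) := Finset.sum_le_sum fun b _ => by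
        have := Real.negMulLog_le_one_sub_self (hp.1 b)
        have := hp.1 b
        linarith
    _ = Fintype.card B := by simp

end vecEnt

/-- Convolution on a finite group. -/
noncomputable def groupConv {B : Type*} [Fintype B] [AddCommGroup B] (p q : B → ℝ) (b : B) : ℝ :=
  ∑ c, q c * p (b - c)

section convolution
variable {B : Type*} [Fintype B] [AddCommGroup B]

lemma groupConv_comm (p q : B → ℝ) : groupConv p q = groupConv q p := by
  funext b
  unfold groupConv
  rw [← (Equiv.subLeft b).sum_comp]
  refine Finset.sum_congr rfl fun c _ => ?_
  simp [mul_comm]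

lemma groupConv_mem {p q : B → ℝ} (hp : p ∈ stdSimplex ℝ B) (hq : q ∈ stdSimplex ℝ B) :
    groupConv p q ∈ stdSimplex ℝ B := by
  refine ⟨fun b => Finset.sum_nonneg fun c _ => mul_nonneg (hq.1 c) (hp.1 _), ?_⟩
  unfold groupConv
  rw [Finset.sum_comm]
  have h : ∀ c, ∑ b, p (b - c) = 1 := fun c => ((Equiv.subRight c).sum_comp p).trans hp.2
  simp only [← Finset.mul_sum, h, mul_one, hq.2]

lemma vecEnt_shift (p : B → ℝ) (c : B) : ∑ b, Real.negMulLog (p (b - c)) = vecEnt p :=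
  (Equiv.subRight c).sum_comp (fun b => Real.negMulLog (p b))

lemma sum_mul_vecEnt_shift {p q : B → ℝ} (hq : q ∈ stdSimplex ℝ B) :
    ∑ b, ∑ c, q c • Real.negMulLog (p (b - c)) = vecEnt p := by
  rw [Finset.sum_comm]
  simp only [smul_eq_mul, ← Finset.mul_sum, vecEnt_shift, ← Finset.sum_mul, hq.2, one_mul]

lemma negMulLog_shift_le {p q : B → ℝ} (hp : p ∈ stdSimplex ℝ B) (hq : q ∈ stdSimplex ℝ B) (b : B) :
    ∑ c, q c • Real.negMulLog (p (b - c)) ≤ Real.negMulLog (groupConv p q b) :=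
  Real.concaveOn_negMulLog.le_map_sum (fun c _ => hq.1 c) hq.2 (fun c _ => hp.1 (b - c))

lemma vecEnt_le_groupConv {p q : B → ℝ} (hp : p ∈ stdSimplex ℝ B) (hq : q ∈ stdSimplex ℝ B) :
    vecEnt p ≤ vecEnt (groupConv p q) := by
  rw [← sum_mul_vecEnt_shift hq]
  exact Finset.sum_le_sum fun b _ => negMulLog_shift_le hp hq b

lemma shift_eq_of_vecEnt_groupConv_eq {p q : B → ℝ} (hp : p ∈ stdSimplex ℝ B)
    (hq : q ∈ stdSimplex ℝ B) (h : vecEnt (groupConv p q) = vecEnt p) {c c' : B} (hc : q c ≠ 0)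
    (hc' : q c' ≠ 0) (b : B) : p (b - c) = p (b - c') := by
  rw [← sum_mul_vecEnt_shift (p := p) hq] at h
  have h2 := (Finset.sum_eq_sum_iff_of_le
    (fun b (_ : b ∈ Finset.univ) => negMulLog_shift_le hp hq b)).1 h.symm b (Finset.mem_univ b)
  exact (Real.strictConcaveOn_negMulLog.map_sum_eq_iff_of_nonneg (fun c _ => hq.1 c) hq.2
    (fun c _ => hp.1 (b - c))).1 h2.symm (Finset.mem_univ c) hc (Finset.mem_univ c') hc'

/-- A distribution is uniform on a coset of a subgroup when its convolution with some
distribution of the same entropy does not increase the entropy. -/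
lemma exists_vecEnt_eq_log {p q : B → ℝ} (hp : p ∈ stdSimplex ℝ B) (hq : q ∈ stdSimplex ℝ B)
    (h1 : vecEnt (groupConv p q) = vecEnt p) (h2 : vecEnt (groupConv p q) = vecEnt q) :
    ∃ K : AddSubgroup B, vecEnt p = Real.log (Nat.card K) := by
  rw [groupConv_comm] at h2
  let K : AddSubgroup B :=
    { carrier := {g | ∀ b, p (b + g) = p b}
      zero_mem' := by simp
      add_mem' := by
        intro x y hx hy b
        rw [← add_assoc, hy, hx]
      neg_mem' := by
        intro x hx b
        rw [← hx (b + -x)]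
        simp }
  have hK : ∀ g, g ∈ K ↔ ∀ b, p (b + g) = p b := fun g => Iff.rfl
  obtain ⟨a, ha⟩ := exists_ne_zero_of_mem_stdSimplex hp
  obtain ⟨c, hc⟩ := exists_ne_zero_of_mem_stdSimplex hq
  have hin : ∀ g ∈ K, p (a + g) = p a := fun g hg => hg a
  have hout : ∀ g ∉ K, p (a + g) = 0 := by
    intro g hg
    by_contra h0
    apply hg
    have hcg : q (c + g) ≠ 0 := by
      have := shift_eq_of_vecEnt_groupConv_eq hq hp h2 h0 ha (c + g + a)
      rw [show c + g + a - (a + g) = c by abel, show c + g + a - a = c + g by abel] at this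
      rwa [← this]
    rw [hK]
    intro b
    have := shift_eq_of_vecEnt_groupConv_eq hp hq h1 hc hcg (b + c + g)
    rwa [show b + c + g - c = b + g by abel, show b + c + g - (c + g) = b by abel] at this
  have hpa : ∀ g, p (a + g) = if g ∈ K then p a else 0 := by
    intro g
    split_ifs with hg
    · exact hin g hg
    · exact hout g hg
  have hsum : ∀ φ : ℝ → ℝ, φ 0 = 0 → ∑ b, φ (p b) = Nat.card K * φ (p a) := by
    intro φ hφ
    rw [← Equiv.sum_comp (Equiv.addLeft a)]
    simp only [Equiv.coe_addLeft, hpa, apply_ite φ, hφ]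
    rw [← Finset.sum_filter, Finset.sum_const, nsmul_eq_mul, Nat.card_eq_fintype_card,
      Fintype.card_subtype]
  have hcard := hsum id rfl
  simp only [id, hp.2] at hcard
  refine ⟨K, ?_⟩
  have hpos : (Nat.card K : ℝ) ≠ 0 := by
    intro h0
    rw [h0, zero_mul] at hcard
    exact one_ne_zero hcard
  have hpa' : p a = (Nat.card K : ℝ)⁻¹ := by
    field_simp
    linarith
  rw [vecEnt, hsum _ Real.negMulLog_zero, hpa', Real.negMulLog, Real.log_inv]
  field_simp

lemma continuous_groupConv : Continuous fun z : (B → ℝ) × (B → ℝ) => groupConv z.1 z.2 := by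
  unfold groupConv
  fun_prop

end convolution

/-- On a compact set, a continuous function vanishing on the zero set of a nonnegative continuous
function `f` is bounded by a multiple of `f`, up to `ε`. -/
lemma exists_le_add_mul_of_isCompact {E : Type*} [TopologicalSpace E] {K : Set E}
    (hK : IsCompact K) {f g : E → ℝ} (hf : Continuous f) (hg : Continuous g)
    (hf0 : ∀ x ∈ K, 0 ≤ f x) (hfg : ∀ x ∈ K, f x = 0 → g x ≤ 0) {ε : ℝ} (hε : 0 < ε) :
    ∃ C : ℝ, 0 ≤ C ∧ ∀ x ∈ K, g x ≤ ε + C * f x := by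
  have hK' : IsCompact (K ∩ {x | ε ≤ g x}) := hK.inter_right (isClosed_le continuous_const hg)
  rcases (K ∩ {x | ε ≤ g x}).eq_empty_or_nonempty with he | hne
  · refine ⟨0, le_rfl, fun x hx => ?_⟩
    by_contra! hlt
    have : x ∈ K ∩ {x | ε ≤ g x} := ⟨hx, by simp only [Set.mem_ofPred_eq]; linarith⟩
    simp [he] at this
  · obtain ⟨x0, hx0, hmin⟩ := hK'.exists_isMinOn hne hf.continuousOn
    obtain ⟨x1, hx1, hmax⟩ := hK'.exists_isMaxOn hne hg.continuousOn
    have hfx0 : 0 < f x0 := (hf0 x0 hx0.1).lt_of_ne fun h => by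
      have := hfg x0 hx0.1 h.symm
      have := hx0.2
      simp only [Set.mem_ofPred_eq] at this
      linarith
    have hgx1 : 0 ≤ g x1 := hε.le.trans hx1.2
    refine ⟨g x1 / f x0, by positivity, fun x hx => ?_⟩
    rcases le_or_gt ε (g x) with h | h
    · have h1 : g x ≤ g x1 := hmax ⟨hx, h⟩
      have h2 : f x0 ≤ f x := hmin ⟨hx, h⟩
      have h3 : g x1 = g x1 / f x0 * f x0 := by field_simp
      have h4 : g x1 / f x0 * f x0 ≤ g x1 / f x0 * f x := by gcongr
      linarith
    · have : 0 ≤ g x1 / f x0 * f x := mul_nonneg (by positivity) (hf0 x hx)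
      linarith

/-- The integers `0, …, s` as real numbers. -/
def natPoints (s : ℕ) : Set ℝ := (fun t : ℕ => (t : ℝ)) '' Set.Iic s

lemma natPoints_nonempty (s : ℕ) : (natPoints s).Nonempty := ⟨0, 0, by simp, by simp⟩

lemma exists_abs_sub_eq_infDist (s : ℕ) (x : ℝ) :
    ∃ t : ℕ, t ≤ s ∧ |x - t| = Metric.infDist x (natPoints s) := by
  have hc : IsCompact (natPoints s) := ((Set.finite_Iic s).image _).isCompact
  obtain ⟨_, ⟨t, ht, rfl⟩, h⟩ := hc.exists_infDist_eq_dist (natPoints_nonempty s) x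
  exact ⟨t, ht, by rw [h, Real.dist_eq]⟩

lemma exists_defect_bound {B : Type*} [Fintype B] [AddCommGroup B] {s : ℕ}
    (hB : Nat.card B = 2 ^ s) {ε : ℝ} (hε : 0 < ε) :
    ∃ C : ℝ, 0 ≤ C ∧ ∀ p ∈ stdSimplex ℝ B, ∀ q ∈ stdSimplex ℝ B,
      |vecEnt p - vecEnt q| / Real.log 2
        + Metric.infDist (vecEnt q / Real.log 2) (natPoints s)
        ≤ ε + C * (2 * vecEnt (groupConv p q) - vecEnt p - vecEnt q) := by
  have c1 : Continuous fun z : (B → ℝ) × (B → ℝ) => vecEnt z.1 :=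
    continuous_vecEnt.comp continuous_fst
  have c2 : Continuous fun z : (B → ℝ) × (B → ℝ) => vecEnt z.2 :=
    continuous_vecEnt.comp continuous_snd
  have c3 : Continuous fun z : (B → ℝ) × (B → ℝ) => vecEnt (groupConv z.1 z.2) :=
    continuous_vecEnt.comp continuous_groupConv
  have hnn : ∀ z ∈ stdSimplex ℝ B ×ˢ stdSimplex ℝ B,
      0 ≤ 2 * vecEnt (groupConv z.1 z.2) - vecEnt z.1 - vecEnt z.2 := by
    rintro ⟨p, q⟩ ⟨hp, hq⟩
    have h1 := vecEnt_le_groupConv hp hq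
    have h2 := vecEnt_le_groupConv hq hp
    rw [groupConv_comm] at h2
    simp only
    linarith
  have hzero : ∀ z ∈ stdSimplex ℝ B ×ˢ stdSimplex ℝ B,
      2 * vecEnt (groupConv z.1 z.2) - vecEnt z.1 - vecEnt z.2 = 0 →
      |vecEnt z.1 - vecEnt z.2| / Real.log 2
        + Metric.infDist (vecEnt z.2 / Real.log 2) (natPoints s) ≤ 0 := by
    rintro ⟨p, q⟩ ⟨hp, hq⟩ h0
    have h1 := vecEnt_le_groupConv hp hq
    have h2 := vecEnt_le_groupConv hq hp
    rw [groupConv_comm] at h2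
    simp only at h0 hp hq ⊢
    have e1 : vecEnt (groupConv p q) = vecEnt p := by linarith
    have e2 : vecEnt (groupConv p q) = vecEnt q := by linarith
    obtain ⟨K, hK⟩ := exists_vecEnt_eq_log hp hq e1 e2
    have hdvd : Nat.card K ∣ 2 ^ s := hB ▸ K.card_addSubgroup_dvd_card
    obtain ⟨t, ht, hKt⟩ := (Nat.dvd_prime_pow Nat.prime_two).1 hdvd
    rw [← e2, e1, sub_self, abs_zero, zero_div, zero_add, hK, hKt]
    apply le_of_eq
    apply Metric.infDist_zero_of_mem
    refine ⟨t, ht, ?_⟩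
    have := Real.log_pos (by norm_num : (1 : ℝ) < 2)
    simp only [Nat.cast_pow, Nat.cast_ofNat, Real.log_pow]
    field_simp
  obtain ⟨C, hC, h⟩ := exists_le_add_mul_of_isCompact
    ((isCompact_stdSimplex ℝ B).prod (isCompact_stdSimplex ℝ B))
    (f := fun z => 2 * vecEnt (groupConv z.1 z.2) - vecEnt z.1 - vecEnt z.2)
    (g := fun z => |vecEnt z.1 - vecEnt z.2| / Real.log 2
      + Metric.infDist (vecEnt z.2 / Real.log 2) (natPoints s))
    (((continuous_const.mul c3).sub c1).sub c2)
    (((c1.sub c2).abs.div_const _).add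
      ((Metric.continuous_infDist_pt _).comp (c2.div_const _))) hnn hzero hε
  exact ⟨C, hC, fun p hp q hq => h (p, q) ⟨hp, hq⟩⟩

section disintegration
variable {Ω : Type*} [Fintype Ω] {B Q : Type*} [Fintype B] [Fintype Q]

lemma sum_negMulLog_mul_sub (r : Q → ℝ) {p : Q → B → ℝ} (hp : ∀ c, p c ∈ stdSimplex ℝ B) :
    (∑ z : B × Q, Real.negMulLog (r z.2 * p z.2 z.1)) - ∑ c, Real.negMulLog (r c)
      = ∑ c, r c * vecEnt (p c) := by
  simp only [Fintype.sum_prod_type, Real.negMulLog_mul]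
  rw [Finset.sum_comm]
  simp only [Finset.sum_add_distrib, ← Finset.sum_mul, ← Finset.mul_sum, (hp _).2, one_mul]
  simp only [vecEnt]
  ring

lemma wEnt_pair_sub {w : Ω → ℝ} {U : Ω → B} {q : Ω → Q} {r : Q → ℝ} {p : Q → B → ℝ}
    (hp : ∀ c, p c ∈ stdSimplex ℝ B) (hr : ∀ c, mass w q c = r c)
    (hrp : ∀ b c, mass w (fun x => (U x, q x)) (b, c) = r c * p c b) :
    wEnt w (fun x => (U x, q x)) - wEnt w q = ∑ c, r c * vecEnt (p c) := by
  rw [wEnt_eq_sum_negMulLog, wEnt_eq_sum_negMulLog, ← sum_negMulLog_mul_sub r hp]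
  simp only [hr, ← hrp]

lemma exists_disintegration {w : Ω → ℝ} (hw : ∀ x, 0 ≤ w x) (hw1 : ∑ x, w x = 1)
    [Nonempty B] (U : Ω → B) (q : Ω → Q) :
    ∃ (r : Q → ℝ) (p : Q → B → ℝ), (∀ c, 0 ≤ r c) ∧ ∑ c, r c = 1 ∧
      (∀ c, p c ∈ stdSimplex ℝ B) ∧ (∀ c, mass w q c = r c) ∧
      ∀ b c, mass w (fun x => (U x, q x)) (b, c) = r c * p c b := by
  have b0 : B := Classical.arbitrary B
  have hpair := sum_mass_pair w U q
  have hnn : ∀ z, 0 ≤ mass w (fun x => (U x, q x)) z := mass_nonneg hw _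
  refine ⟨mass w q, fun c b => if mass w q c = 0 then (if b = b0 then 1 else 0)
    else mass w (fun x => (U x, q x)) (b, c) / mass w q c, mass_nonneg hw q,
    (sum_mass w q).trans hw1, fun c => ⟨fun b => ?_, ?_⟩, fun c => rfl, fun b c => ?_⟩
  · simp only
    split_ifs
    · exact zero_le_one
    · exact le_rfl
    · exact div_nonneg (hnn _) (mass_nonneg hw _ _)
  · by_cases h : mass w q c = 0
    · simp [h]
    · simp only [h, if_false, ← Finset.sum_div, hpair]
      exact div_self h
  · by_cases h : mass w q c = 0
    · rw [h, zero_mul]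
      exact (Finset.sum_eq_zero_iff_of_nonneg fun b _ => hnn (b, c)).1 ((hpair c).trans h) b
        (Finset.mem_univ b)
    · simp only [h, if_false]
      field_simp

end disintegration

section polarStep
variable {Ω : Type*} [Fintype Ω] {A B Q : Type*}

lemma mass_add_pair [Fintype B] [AddCommGroup B] (w : Ω → ℝ) (U : Ω → B) (q : Ω → Q) (b : B)
    (c c' : Q) :
    mass (fun z : Ω × Ω => w z.1 * w z.2) (fun z => (U z.1 + U z.2, q z.1, q z.2)) (b, c, c')
      = ∑ d, mass w (fun x => (U x, q x)) (b - d, c) * mass w (fun x => (U x, q x)) (d, c') := by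
  simp only [mass, Finset.sum_mul_sum]
  rw [Fintype.sum_prod_type]
  symm
  rw [Finset.sum_comm]
  refine Finset.sum_congr rfl fun x _ => ?_
  rw [Finset.sum_comm]
  refine Finset.sum_congr rfl fun y _ => ?_
  rw [Finset.sum_eq_single (U y)]
  · by_cases h1 : q x = c <;> by_cases h2 : q y = c' <;> simp [h1, h2, eq_sub_iff_add_eq]
  · intro d _ hd
    simp [hd.symm]
  · simp

lemma wEnt_pair_sub_bounds {w : Ω → ℝ} (hw : ∀ x, 0 ≤ w x) (hw1 : ∑ x, w x = 1)
    [Fintype B] [Nonempty B] [Fintype Q] (U : Ω → B) (q : Ω → Q) :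
    0 ≤ wEnt w (fun x => (U x, q x)) - wEnt w q ∧
      wEnt w (fun x => (U x, q x)) - wEnt w q ≤ Fintype.card B := by
  obtain ⟨r, p, hr, hr1, hp, hm, hmp⟩ := exists_disintegration hw hw1 U q
  rw [wEnt_pair_sub hp hm hmp]
  refine ⟨Finset.sum_nonneg fun c _ => mul_nonneg (hr c) (vecEnt_nonneg (hp c)), ?_⟩
  calc ∑ c, r c * vecEnt (p c) ≤ ∑ c, r c * (Fintype.card B : ℝ) :=
        Finset.sum_le_sum fun c _ => mul_le_mul_of_nonneg_left (vecEnt_le_card (hp c)) (hr c)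
    _ = Fintype.card B := by rw [← Finset.sum_mul, hr1, one_mul]

lemma exists_polar_minus {w : Ω → ℝ} (hw : ∀ x, 0 ≤ w x) (hw1 : ∑ x, w x = 1)
    [Fintype B] [AddCommGroup B] [Fintype Q] (U : Ω → B) (q : Ω → Q) :
    ∃ (r : Q → ℝ) (p : Q → B → ℝ), (∀ c, 0 ≤ r c) ∧ ∑ c, r c = 1 ∧ (∀ c, p c ∈ stdSimplex ℝ B) ∧
      wEnt w (fun x => (U x, q x)) - wEnt w q = ∑ c, r c * vecEnt (p c) ∧
      wEnt (fun z : Ω × Ω => w z.1 * w z.2) (fun z => (U z.1 + U z.2, q z.1, q z.2))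
        - wEnt (fun z : Ω × Ω => w z.1 * w z.2) (fun z => (q z.1, q z.2))
        = ∑ c, ∑ c', r c * r c' * vecEnt (groupConv (p c) (p c')) := by
  obtain ⟨r, p, hr, hr1, hp, hm, hmp⟩ := exists_disintegration hw hw1 U q
  refine ⟨r, p, hr, hr1, hp, wEnt_pair_sub hp hm hmp, ?_⟩
  rw [wEnt_pair_sub (r := fun z : Q × Q => r z.1 * r z.2)
    (p := fun z => groupConv (p z.1) (p z.2)) (fun z => groupConv_mem (hp _) (hp _)),
    Fintype.sum_prod_type]
  · rintro ⟨c, c'⟩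
    rw [mass_prod, hm, hm]
  · rintro b ⟨c, c'⟩
    rw [mass_add_pair]
    simp only [hmp, groupConv, Finset.mul_sum]
    exact Finset.sum_congr rfl fun d _ => by ring

lemma polar_minus_add_plus_le {w : Ω → ℝ} (hw : ∀ x, 0 ≤ w x) (hw1 : ∑ x, w x = 1)
    [Fintype A] [AddCommGroup A] [Fintype B] [AddCommGroup B] [Fintype Q]
    (π : A →+ B) (F : Ω → A) (q : Ω → Q) :
    (wEnt (fun z : Ω × Ω => w z.1 * w z.2) (fun z => (π (F z.1) + π (F z.2), q z.1, q z.2))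
        - wEnt (fun z : Ω × Ω => w z.1 * w z.2) (fun z => (q z.1, q z.2)))
      + (wEnt (fun z : Ω × Ω => w z.1 * w z.2) (fun z => (π (F z.2), F z.1 + F z.2, q z.1, q z.2))
        - wEnt (fun z : Ω × Ω => w z.1 * w z.2) (fun z => (F z.1 + F z.2, q z.1, q z.2)))
      ≤ 2 * (wEnt w (fun x => (π (F x), q x)) - wEnt w q) := by
  have hs := wEnt_submodular (w := fun z : Ω × Ω => w z.1 * w z.2)
    (fun z => mul_nonneg (hw _) (hw _))
    (by rw [Fintype.sum_prod_type]; simp only [← Finset.mul_sum, ← Finset.sum_mul, hw1, one_mul])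
    (fun z => π (F z.2)) (fun z => F z.1 + F z.2) (fun z => (π (F z.1) + π (F z.2), q z.1, q z.2))
  have p1 := wEnt_prod hw hw1 (fun x => (π (F x), q x))
  have p2 := wEnt_prod hw hw1 q
  rw [wEnt_congr (g := fun z : Ω × Ω => (π (F z.2), F z.1 + F z.2, q z.1, q z.2)),
    wEnt_congr (f := fun z : Ω × Ω => (π (F z.2), π (F z.1) + π (F z.2), q z.1, q z.2))
      (g := fun z : Ω × Ω => ((π (F z.1), q z.1), (π (F z.2), q z.2))),
    wEnt_congr (f := fun z : Ω × Ω => (F z.1 + F z.2, π (F z.1) + π (F z.2), q z.1, q z.2))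
      (g := fun z : Ω × Ω => (F z.1 + F z.2, q z.1, q z.2))] at hs
  · linarith
  · intro x y
    simp only [← map_add, Prod.mk.injEq]
    constructor
    · rintro ⟨h1, -, h2, h3⟩
      exact ⟨h1, h2, h3⟩
    · rintro ⟨h1, h2, h3⟩
      exact ⟨h1, by rw [h1], h2, h3⟩
  · intro x y
    simp only [Prod.mk.injEq]
    constructor
    · rintro ⟨h1, h2, h3, h4⟩
      rw [h1] at h2
      exact ⟨⟨add_right_cancel h2, h3⟩, h1, h4⟩
    · rintro ⟨⟨h1, h2⟩, h3, h4⟩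
      exact ⟨h3, by rw [h1, h3], h2, h4⟩
  · intro x y
    simp only [← map_add, Prod.mk.injEq]
    constructor
    · rintro ⟨h0, h1, -, h2, h3⟩
      exact ⟨h0, h1, h2, h3⟩
    · rintro ⟨h0, h1, h2, h3⟩
      exact ⟨h0, h1, by rw [h1], h2, h3⟩

lemma infDist_le_polar_minus {w : Ω → ℝ} (hw : ∀ x, 0 ≤ w x) (hw1 : ∑ x, w x = 1)
    [Fintype B] [AddCommGroup B] [Fintype Q] (U : Ω → B) (q : Ω → Q)
    {s : ℕ} {ε C : ℝ}
    (hC : ∀ p ∈ stdSimplex ℝ B, ∀ q ∈ stdSimplex ℝ B,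
      |vecEnt p - vecEnt q| / Real.log 2
        + Metric.infDist (vecEnt q / Real.log 2) (natPoints s)
        ≤ ε + C * (2 * vecEnt (groupConv p q) - vecEnt p - vecEnt q)) :
    Metric.infDist ((wEnt w (fun x => (U x, q x)) - wEnt w q) / Real.log 2) (natPoints s)
      ≤ ε + 2 * C * ((wEnt (fun z : Ω × Ω => w z.1 * w z.2)
            (fun z => (U z.1 + U z.2, q z.1, q z.2))
          - wEnt (fun z : Ω × Ω => w z.1 * w z.2) (fun z => (q z.1, q z.2)))
        - (wEnt w (fun x => (U x, q x)) - wEnt w q)) := by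
  obtain ⟨r, p, hr, hr1, hp, e1, e2⟩ := exists_polar_minus hw hw1 U q
  rw [e1, e2]
  set H := ∑ c, r c * vecEnt (p c) with hH
  have hlog : 0 < Real.log 2 := Real.log_pos (by norm_num)
  have hdev : ∀ c', |H - vecEnt (p c')| ≤ ∑ c, r c * |vecEnt (p c) - vecEnt (p c')| := by
    intro c'
    have : H - vecEnt (p c') = ∑ c, r c * (vecEnt (p c) - vecEnt (p c')) := by
      simp only [mul_sub, Finset.sum_sub_distrib, ← Finset.sum_mul, hr1, one_mul, hH]
    rw [this]
    refine (Finset.abs_sum_le_sum_abs _ _).trans (le_of_eq ?_)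
    simp only [abs_mul, abs_of_nonneg (hr _)]
  have hpt : ∀ c', Metric.infDist (H / Real.log 2) (natPoints s) ≤
      ∑ c, r c * (ε + C * (2 * vecEnt (groupConv (p c) (p c')) - vecEnt (p c) - vecEnt (p c'))) := by
    intro c'
    calc Metric.infDist (H / Real.log 2) (natPoints s)
        ≤ Metric.infDist (vecEnt (p c') / Real.log 2) (natPoints s)
          + dist (H / Real.log 2) (vecEnt (p c') / Real.log 2) := Metric.infDist_le_infDist_add_dist
      _ = Metric.infDist (vecEnt (p c') / Real.log 2) (natPoints s)
          + |H - vecEnt (p c')| / Real.log 2 := by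
          rw [Real.dist_eq, ← sub_div, abs_div, abs_of_pos hlog]
      _ ≤ Metric.infDist (vecEnt (p c') / Real.log 2) (natPoints s)
          + (∑ c, r c * |vecEnt (p c) - vecEnt (p c')|) / Real.log 2 := by
          gcongr
          exact hdev c'
      _ = ∑ c, r c * (|vecEnt (p c) - vecEnt (p c')| / Real.log 2
          + Metric.infDist (vecEnt (p c') / Real.log 2) (natPoints s)) := by
          simp only [mul_add, Finset.sum_add_distrib, ← Finset.sum_mul, hr1, one_mul,
            Finset.sum_div, mul_div_assoc]
          ring
      _ ≤ _ := Finset.sum_le_sum fun c _ =>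
          mul_le_mul_of_nonneg_left (hC _ (hp c) _ (hp c')) (hr c)
  have hE : ∀ c', ∑ c, r c * (ε + C * (2 * vecEnt (groupConv (p c) (p c'))
      - vecEnt (p c) - vecEnt (p c')))
      = ε + C * (2 * (∑ c, r c * vecEnt (groupConv (p c) (p c'))) - H - vecEnt (p c')) := by
    intro c'
    have : ∀ c, r c * (ε + C * (2 * vecEnt (groupConv (p c) (p c')) - vecEnt (p c) - vecEnt (p c')))
        = r c * (ε - C * vecEnt (p c')) + 2 * C * (r c * vecEnt (groupConv (p c) (p c')))
          - C * (r c * vecEnt (p c)) := fun c => by ring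
    simp only [this, Finset.sum_sub_distrib, Finset.sum_add_distrib, ← Finset.sum_mul,
      ← Finset.mul_sum, hr1, ← hH]
    ring
  have hfin := Finset.sum_le_sum fun c' (_ : c' ∈ Finset.univ) =>
    mul_le_mul_of_nonneg_left ((hpt c').trans_eq (hE c')) (hr c')
  rw [← Finset.sum_mul, hr1, one_mul] at hfin
  refine hfin.trans (le_of_eq ?_)
  have : ∀ c', r c' * (ε + C * (2 * (∑ c, r c * vecEnt (groupConv (p c) (p c'))) - H
      - vecEnt (p c')))
      = r c' * (ε - C * H) + 2 * C * (∑ c, r c * r c' * vecEnt (groupConv (p c) (p c')))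
        - C * (r c' * vecEnt (p c')) := by
    intro c'
    have : ∑ c, r c * r c' * vecEnt (groupConv (p c) (p c'))
        = r c' * ∑ c, r c * vecEnt (groupConv (p c) (p c')) := by
      rw [Finset.mul_sum]
      exact Finset.sum_congr rfl fun c _ => by ring
    rw [this]
    ring
  simp only [this, Finset.sum_sub_distrib, Finset.sum_add_distrib, ← Finset.sum_mul,
      ← Finset.mul_sum, hr1, ← hH]
  rw [Finset.sum_comm]
  ring

end polarStep

lemma sum_range_two_mul {M : Type*} [AddCommMonoid M] (F : ℕ → M) (n : ℕ) :
    ∑ j ∈ Finset.range (2 * n), F j = ∑ j ∈ Finset.range n, (F (2 * j) + F (2 * j + 1)) := by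
  induction n with
  | zero => simp
  | succ n ih =>
    rw [show 2 * (n + 1) = 2 * n + 1 + 1 by ring, Finset.sum_range_succ, Finset.sum_range_succ, ih,
      Finset.sum_range_succ, add_assoc]

/-- Along a bounded supermartingale on the binary tree, the mean
squared increment to the left child tends to zero. -/
lemma tendsto_average_sq_increment {I : ℕ → ℕ → ℝ} {K : ℝ} (h0 : ∀ k j, 0 ≤ I k j)
    (hK : ∀ k j, I k j ≤ K)
    (hp : ∀ k j, I (k + 1) (2 * j) + I (k + 1) (2 * j + 1) ≤ 2 * I k j) :
    Tendsto (fun k => (∑ j ∈ Finset.range (2 ^ k), (I (k + 1) (2 * j) - I k j) ^ 2) / 2 ^ k)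
      atTop (nhds 0) := by
  set P : ℕ → ℝ := fun k => (∑ j ∈ Finset.range (2 ^ k), ((I k j) ^ 2 - 2 * K * I k j)) / 2 ^ k
    with hP
  set d : ℕ → ℝ := fun k =>
    (∑ j ∈ Finset.range (2 ^ k), (I (k + 1) (2 * j) - I k j) ^ 2) / 2 ^ k with hd
  have hd0 : ∀ k, 0 ≤ d k := fun k =>
    div_nonneg (Finset.sum_nonneg fun j _ => sq_nonneg _) (by positivity)
  have hstep : ∀ k, d k ≤ 2 * (P (k + 1) - P k) := by
    intro k
    have hs : ∀ j, 2 * ((I k j) ^ 2 - 2 * K * I k j) + (I (k + 1) (2 * j) - I k j) ^ 2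
        ≤ ((I (k + 1) (2 * j)) ^ 2 - 2 * K * I (k + 1) (2 * j))
          + ((I (k + 1) (2 * j + 1)) ^ 2 - 2 * K * I (k + 1) (2 * j + 1)) := by
      intro j
      nlinarith [sq_nonneg (I k j - I (k + 1) (2 * j + 1)),
        mul_nonneg (sub_nonneg.2 (hK k j)) (sub_nonneg.2 (hp k j))]
    have hsum := Finset.sum_le_sum fun j (_ : j ∈ Finset.range (2 ^ k)) => hs j
    rw [Finset.sum_add_distrib, ← Finset.mul_sum,
      ← sum_range_two_mul (fun j => (I (k + 1) j) ^ 2 - 2 * K * I (k + 1) j), ← pow_succ'] at hsum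
    have h2 : (0 : ℝ) < 2 ^ k := by positivity
    simp only [hd, hP, pow_succ (2 : ℝ) k]
    have hscale : ∀ a b : ℝ, 2 * (a / (2 ^ k * 2) - b / 2 ^ k) * 2 ^ k = a - 2 * b := by
      intro a b
      field_simp
    rw [div_le_iff₀ h2, hscale]
    linarith
  have hmono : Monotone P := monotone_nat_of_le_succ fun k => by
    linarith [hd0 k, hstep k]
  have hbdd : BddAbove (Set.range P) := by
    refine ⟨0, ?_⟩
    rintro _ ⟨k, rfl⟩
    refine div_nonpos_of_nonpos_of_nonneg (Finset.sum_nonpos fun j _ => ?_) (by positivity)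
    nlinarith [h0 k j, hK k j, mul_nonneg (h0 k j) (sub_nonneg.2 (hK k j))]
  have hlim := tendsto_atTop_ciSup hmono hbdd
  have hdiff : Tendsto (fun k => 2 * (P (k + 1) - P k)) atTop (nhds 0) := by
    simpa using (((tendsto_add_atTop_iff_nat 1).2 hlim).sub hlim).const_mul 2
  exact squeeze_zero hd0 hstep hdiff

lemma tendsto_average_of_le_increment {I D : ℕ → ℕ → ℝ} {K : ℝ} (h0 : ∀ k j, 0 ≤ I k j)
    (hK : ∀ k j, I k j ≤ K)
    (hp : ∀ k j, I (k + 1) (2 * j) + I (k + 1) (2 * j + 1) ≤ 2 * I k j)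
    (hD0 : ∀ k j, 0 ≤ D k j)
    (hD : ∀ ε : ℝ, 0 < ε → ∃ C : ℝ, ∀ k j, D k j ≤ ε + C * (I (k + 1) (2 * j) - I k j)) :
    Tendsto (fun k => (∑ j ∈ Finset.range (2 ^ k), D k j) / 2 ^ k) atTop (nhds 0) := by
  have hsq := tendsto_average_sq_increment h0 hK hp
  have havg0 : ∀ k, 0 ≤ (∑ j ∈ Finset.range (2 ^ k), D k j) / 2 ^ k := fun k =>
    div_nonneg (Finset.sum_nonneg fun j _ => hD0 k j) (by positivity)
  rw [tendsto_order]
  refine ⟨fun a ha => Eventually.of_forall fun k => ha.trans_le (havg0 k), fun a ha => ?_⟩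
  obtain ⟨C, hC⟩ := hD (a / 4) (by positivity)
  have hlim : Tendsto (fun k => a / 2 + C ^ 2 / a *
      ((∑ j ∈ Finset.range (2 ^ k), (I (k + 1) (2 * j) - I k j) ^ 2) / 2 ^ k)) atTop
      (nhds (a / 2)) := by
    simpa using (hsq.const_mul (C ^ 2 / a)).const_add (a / 2)
  filter_upwards [hlim.eventually_lt_const (by linarith : a / 2 < a)] with k hk
  refine lt_of_le_of_lt ?_ hk
  have h2 : (0 : ℝ) < 2 ^ k := by positivity
  have hpt : ∀ j, D k j ≤ a / 2 + C ^ 2 / a * (I (k + 1) (2 * j) - I k j) ^ 2 := by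
    intro j
    refine (hC k j).trans ?_
    set t := I (k + 1) (2 * j) - I k j
    have : a / 2 + C ^ 2 / a * t ^ 2 - (a / 4 + C * t) = (C * t - a / 2) ^ 2 / a := by
      field_simp
      ring
    have h3 : 0 ≤ (C * t - a / 2) ^ 2 / a := by positivity
    linarith
  rw [div_le_iff₀ h2]
  refine (Finset.sum_le_sum fun j _ => hpt j).trans (le_of_eq ?_)
  rw [Finset.sum_add_distrib, ← Finset.mul_sum, Finset.sum_const, Finset.card_range, nsmul_eq_mul]
  push_cast
  field_simp

section interleave
variable {A : Type*}

/-- Interleaving of two sequences. -/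
def interleave (A : Type*) (n : ℕ) : (Fin n → A) × (Fin n → A) ≃ (Fin (n * 2) → A) where
  toFun z i := if (finProdFinEquiv.symm i).2 = 0 then z.1 (finProdFinEquiv.symm i).1
    else z.2 (finProdFinEquiv.symm i).1
  invFun x := (fun i => x (finProdFinEquiv (i, 0)), fun i => x (finProdFinEquiv (i, 1)))
  left_inv z := by simp
  right_inv x := by
    funext i
    obtain ⟨⟨a, b⟩, rfl⟩ := finProdFinEquiv.surjective i
    fin_cases b <;> simp

lemma interleave_zero {n : ℕ} (z : (Fin n → A) × (Fin n → A)) (i : Fin n) :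
    interleave A n z (finProdFinEquiv (i, 0)) = z.1 i := by
  simp only [interleave, Equiv.coe_fn_mk, Equiv.symm_apply_apply, if_true]

lemma interleave_one {n : ℕ} (z : (Fin n → A) × (Fin n → A)) (i : Fin n) :
    interleave A n z (finProdFinEquiv (i, 1)) = z.2 i := by
  simp only [interleave, Equiv.coe_fn_mk, Equiv.symm_apply_apply, one_ne_zero, if_false]

lemma prod_interleave {n : ℕ} (p : A → ℝ) (z : (Fin n → A) × (Fin n → A)) :
    ∏ i, p (interleave A n z i) = (∏ i, p (z.1 i)) * ∏ i, p (z.2 i) := by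
  rw [← finProdFinEquiv.prod_comp, Fintype.prod_prod_type, ← Finset.prod_mul_distrib]
  refine Finset.prod_congr rfl fun i _ => ?_
  rw [Fin.prod_univ_two, interleave_zero, interleave_one]

end interleave

lemma and_eq_self_iff (a b : ℕ) :
    a &&& b = a ↔ a / 2 &&& b / 2 = a / 2 ∧ (a % 2 = 1 → b % 2 = 1) := by
  have h1 : (a &&& b) / 2 = a / 2 &&& b / 2 := Nat.and_div_two
  have h2 : (a &&& b) % 2 = 1 ↔ a % 2 = 1 ∧ b % 2 = 1 := Nat.and_mod_two_eq_one
  rw [← h1]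
  omega

section polarTransform
variable {A : Type*} [AddCommGroup A]

/-- The `j`-th column of the polar transform of a sequence of length `n`. -/
def polarCol {n : ℕ} (x : Fin n → A) (j : ℕ) : A :=
  ∑ i : Fin n, if j &&& i.val = j then x i else 0

/-- The columns of the polar transform that precede the `j`-th one. -/
def polarPast {n : ℕ} (j : ℕ) (x : Fin n → A) (i : Fin j) : A := polarCol x i

lemma polarCol_even {n : ℕ} (z : (Fin n → A) × (Fin n → A)) (j : ℕ) :
    polarCol (interleave A n z) (2 * j) = polarCol z.1 j + polarCol z.2 j := by
  unfold polarCol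
  rw [← finProdFinEquiv.sum_comp, Fintype.sum_prod_type, ← Finset.sum_add_distrib]
  refine Finset.sum_congr rfl fun i _ => ?_
  rw [Fin.sum_univ_two, interleave_zero, interleave_one]
  have h1 : 2 * j / 2 = j := by omega
  have h2 : 2 * j % 2 = 0 := by omega
  have h3 : (1 + 2 * i.val) / 2 = i.val := by omega
  simp [finProdFinEquiv_apply_val, and_eq_self_iff (2 * j), h1, h3]

lemma polarCol_odd {n : ℕ} (z : (Fin n → A) × (Fin n → A)) (j : ℕ) :
    polarCol (interleave A n z) (2 * j + 1) = polarCol z.2 j := by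
  unfold polarCol
  rw [← finProdFinEquiv.sum_comp, Fintype.sum_prod_type]
  refine Finset.sum_congr rfl fun i _ => ?_
  rw [Fin.sum_univ_two, interleave_zero, interleave_one]
  have h1 : (2 * j + 1) / 2 = j := by omega
  have h3 : (1 + 2 * i.val) / 2 = i.val := by omega
  simp [finProdFinEquiv_apply_val, and_eq_self_iff (2 * j + 1), h1, h3]

lemma polarPast_eq_iff {n : ℕ} (j : ℕ) (x y : Fin n → A) :
    polarPast j x = polarPast j y ↔ ∀ i < j, polarCol x i = polarCol y i :=
  ⟨fun h i hi => congrFun h ⟨i, hi⟩, fun h => funext fun i => h i i.2⟩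

lemma polarPast_even_iff {n : ℕ} (j : ℕ) (z z' : (Fin n → A) × (Fin n → A)) :
    polarPast (2 * j) (interleave A n z) = polarPast (2 * j) (interleave A n z') ↔
      polarPast j z.1 = polarPast j z'.1 ∧ polarPast j z.2 = polarPast j z'.2 := by
  simp only [polarPast_eq_iff]
  constructor
  · intro h
    have hb : ∀ i < j, polarCol z.2 i = polarCol z'.2 i := fun i hi => by
      rw [← polarCol_odd, ← polarCol_odd]
      exact h _ (by omega)
    refine ⟨fun i hi => ?_, hb⟩
    have := h (2 * i) (by omega)
    rw [polarCol_even, polarCol_even, hb i hi] at this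
    exact add_right_cancel this
  · rintro ⟨h1, h2⟩ i hi
    obtain ⟨l, rfl | rfl⟩ := Nat.even_or_odd' i
    · rw [polarCol_even, polarCol_even, h1 l (by omega), h2 l (by omega)]
    · rw [polarCol_odd, polarCol_odd, h2 l (by omega)]

lemma polarPast_odd_iff {n : ℕ} (j : ℕ) (z z' : (Fin n → A) × (Fin n → A)) :
    polarPast (2 * j + 1) (interleave A n z) = polarPast (2 * j + 1) (interleave A n z') ↔
      polarCol z.1 j + polarCol z.2 j = polarCol z'.1 j + polarCol z'.2 j ∧
      polarPast j z.1 = polarPast j z'.1 ∧ polarPast j z.2 = polarPast j z'.2 := by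
  rw [← polarPast_even_iff, ← polarCol_even, ← polarCol_even]
  simp only [polarPast_eq_iff]
  constructor
  · exact fun h => ⟨h _ (by omega), fun i hi => h i (by omega)⟩
  · rintro ⟨h1, h2⟩ i hi
    rcases (Nat.lt_succ_iff.1 hi).eq_or_lt with rfl | h
    · exact h1
    · exact h2 i h

variable [Fintype A] {B : Type*} [AddCommGroup B]

/-- The entropy in nats of the image under `π` of the `j`-th column of the polar transform of
`2 ^ k` independent samples of law `p`, given the preceding columns. -/
noncomputable def polarEnt (p : A → ℝ) (π : A →+ B) (k j : ℕ) : ℝ :=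
  wEnt (fun x : Fin (2 ^ k) → A => ∏ i, p (x i)) (fun x => (π (polarCol x j), polarPast j x))
    - wEnt (fun x : Fin (2 ^ k) → A => ∏ i, p (x i)) (polarPast j)

lemma polarEnt_even (p : A → ℝ) (π : A →+ B) (k j : ℕ) :
    polarEnt p π (k + 1) (2 * j) =
      wEnt (fun z : (Fin (2 ^ k) → A) × (Fin (2 ^ k) → A) =>
          (∏ i, p (z.1 i)) * ∏ i, p (z.2 i))
        (fun z => (π (polarCol z.1 j) + π (polarCol z.2 j), polarPast j z.1, polarPast j z.2))
      - wEnt (fun z : (Fin (2 ^ k) → A) × (Fin (2 ^ k) → A) =>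
          (∏ i, p (z.1 i)) * ∏ i, p (z.2 i))
        (fun z => (polarPast j z.1, polarPast j z.2)) := by
  unfold polarEnt
  simp only [← prod_interleave]
  congr 1
  · refine (wEnt_equiv (interleave A (2 ^ k)) _ _).trans (wEnt_congr _ fun x y => ?_)
    simp only [Prod.mk.injEq, ← map_add, ← polarCol_even, ← polarPast_even_iff]
    rfl
  · refine (wEnt_equiv (interleave A (2 ^ k)) _ _).trans (wEnt_congr _ fun x y => ?_)
    rw [Prod.mk.injEq, ← polarPast_even_iff]
    rfl

lemma polarEnt_odd (p : A → ℝ) (π : A →+ B) (k j : ℕ) :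
    polarEnt p π (k + 1) (2 * j + 1) =
      wEnt (fun z : (Fin (2 ^ k) → A) × (Fin (2 ^ k) → A) =>
          (∏ i, p (z.1 i)) * ∏ i, p (z.2 i))
        (fun z => (π (polarCol z.2 j), polarCol z.1 j + polarCol z.2 j,
          polarPast j z.1, polarPast j z.2))
      - wEnt (fun z : (Fin (2 ^ k) → A) × (Fin (2 ^ k) → A) =>
          (∏ i, p (z.1 i)) * ∏ i, p (z.2 i))
        (fun z => (polarCol z.1 j + polarCol z.2 j, polarPast j z.1, polarPast j z.2)) := by
  unfold polarEnt
  simp only [← prod_interleave]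
  congr 1
  · refine (wEnt_equiv (interleave A (2 ^ k)) _ _).trans (wEnt_congr _ fun x y => ?_)
    rw [Prod.mk.injEq, Prod.mk.injEq, Prod.mk.injEq, Prod.mk.injEq, ← polarPast_odd_iff,
      ← polarCol_odd, ← polarCol_odd]
    rfl
  · refine (wEnt_equiv (interleave A (2 ^ k)) _ _).trans (wEnt_congr _ fun x y => ?_)
    rw [Prod.mk.injEq, Prod.mk.injEq, ← polarPast_odd_iff]
    rfl

variable [Fintype B]

/-- The conditional entropies of the polarized columns concentrate on the integers. -/
theorem tendsto_average_infDist_polarEnt {p : A → ℝ} (hp : ∀ a, 0 ≤ p a) (hp1 : ∑ a, p a = 1)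
    (π : A →+ B) {s : ℕ} (hB : Nat.card B = 2 ^ s) :
    Tendsto (fun k => (∑ j ∈ Finset.range (2 ^ k),
      Metric.infDist (polarEnt p π k j / Real.log 2) (natPoints s)) / 2 ^ k) atTop (nhds 0) := by
  have hw : ∀ k, ∀ x : Fin (2 ^ k) → A, 0 ≤ ∏ i, p (x i) := fun k x =>
    Finset.prod_nonneg fun i _ => hp _
  have hw1 : ∀ k, ∑ x : Fin (2 ^ k) → A, ∏ i, p (x i) = 1 := fun k => by
    rw [← Fintype.piFinset_univ, ← Finset.prod_univ_sum (fun _ => Finset.univ) (fun _ a => p a)]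
    simp [hp1]
  refine tendsto_average_of_le_increment (I := polarEnt p π) (K := Fintype.card B)
    (fun k j => (wEnt_pair_sub_bounds (hw k) (hw1 k) _ _).1)
    (fun k j => (wEnt_pair_sub_bounds (hw k) (hw1 k) _ _).2) (fun k j => ?_)
    (fun k j => Metric.infDist_nonneg) (fun ε hε => ?_)
  · rw [polarEnt_even, polarEnt_odd]
    exact polar_minus_add_plus_le (hw k) (hw1 k) π (fun x => polarCol x j) (polarPast j)
  · obtain ⟨C, -, hC⟩ := exists_defect_bound hB hε
    refine ⟨2 * C, fun k j => ?_⟩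
    rw [polarEnt_even]
    exact infDist_le_polar_minus (hw k) (hw1 k) (fun x => π (polarCol x j)) (polarPast j) hC

end polarTransform

section link
variable {Ω : Type*} [MeasurableSpace Ω] {μ : Measure Ω}

lemma shEnt_comp_eq_wEnt {A : Type*} [Fintype A] [MeasurableSpace A] [MeasurableSingletonClass A]
    {ν : Measure A} [IsProbabilityMeasure ν] {n : ℕ} {X : Ω → Fin n → A} (hX : Measurable X)
    (h : μ.map X = Measure.pi fun _ => ν) {α : Type*} [Fintype α] (f : (Fin n → A) → α) :
    shEnt μ (fun ω => f (X ω)) = wEnt (fun x => ∏ i, (ν {x i}).toReal) f / Real.log 2 := by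
  rw [wEnt_eq_sum_negMulLog, shEnt]
  congr 1
  refine Finset.sum_congr rfl fun a _ => congrArg _ ?_
  have hpre : (fun ω => f (X ω)) ⁻¹' {a} = X ⁻¹' ((Finset.univ.filter fun x => f x = a :
      Finset (Fin n → A)) : Set (Fin n → A)) := by
    ext ω
    simp
  rw [hpre, ← Measure.map_apply hX (Finset.measurableSet _), h, ← sum_measure_singleton,
    ENNReal.toReal_sum fun x _ => measure_ne_top _ _, Finset.sum_filter, mass]
  refine Finset.sum_congr rfl fun x _ => ?_
  rw [Measure.pi_singleton, ENNReal.toReal_prod]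

lemma mul_G_apply {m k : ℕ} (M : Fin m → Fin (2 ^ k) → ZMod 2) (r : Fin m) (j : Fin (2 ^ k)) :
    (Matrix.of M * G k) r j = polarCol (fun l i => M i l) j.val r := by
  rw [Matrix.mul_apply, polarCol, Finset.sum_apply]
  refine Finset.sum_congr rfl fun l _ => ?_
  simp only [Matrix.of_apply, G]
  split_ifs <;> simp

/-- Restriction of a vector to a set of coordinates. -/
def coordHom {m : ℕ} (S : Finset (Fin m)) : (Fin m → ZMod 2) →+ (S → ZMod 2) :=
  AddMonoidHom.mk' (fun a i => a i.1) fun _ _ => rfl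

lemma cEnt_mul_G_eq {m k : ℕ} {ν : Measure (Fin m → ZMod 2)} [IsProbabilityMeasure ν]
    {X : Ω → Fin m → Fin (2 ^ k) → ZMod 2} (hX : Measurable X)
    (h : μ.map (fun ω => fun j i => X ω i j) = Measure.pi fun _ : Fin (2 ^ k) => ν)
    (S : Finset (Fin m)) (j : Fin (2 ^ k)) :
    cEnt μ (fun ω (i : S) => (Matrix.of (X ω) * G k) i.1 j)
      (fun ω (j' : Fin j.val) (r : Fin m) => (Matrix.of (X ω) * G k) r (j'.castLE j.isLt.le))
      = polarEnt (fun a => (ν {a}).toReal) (coordHom S) k j / Real.log 2 := by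
  have hX' : Measurable (fun ω => fun j i => X ω i j) := by fun_prop
  simp only [mul_G_apply]
  rw [cEnt, polarEnt, sub_div]
  exact congrArg₂ (· - ·)
    (shEnt_comp_eq_wEnt hX' h fun x => (coordHom S (polarCol x j), polarPast j.val x))
    (shEnt_comp_eq_wEnt hX' h (polarPast j.val))

end link

lemma one_sub_le_card_div {n : ℕ} (hn : 0 < n) {ι : Type*} [Fintype ι] {D : ι → ℕ → ℝ}
    (hD : ∀ S j, 0 ≤ D S j) {ε : ℝ} (hε : 0 < ε) {P : Fin n → Prop}
    (hP : ∀ j : Fin n, (∀ S, D S j ≤ ε) → P j) :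
    1 - ∑ S, ((∑ j ∈ Finset.range n, D S j) / n) / ε ≤ (Nat.card {j // P j} : ℝ) / n := by
  have hn' : (0 : ℝ) < n := by exact_mod_cast hn
  have hpt : ∀ j : Fin n, 1 - ∑ S, D S j / ε ≤ if P j then 1 else 0 := by
    intro j
    have h0 : ∀ S, 0 ≤ D S j / ε := fun S => div_nonneg (hD S j) hε.le
    split_ifs with h
    · linarith [Finset.sum_nonneg fun S (_ : S ∈ Finset.univ) => h0 S]
    · obtain ⟨S, hS⟩ : ∃ S, ε < D S j := by
        by_contra! hall
        exact h (hP j hall)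
      have h1 : 1 ≤ D S j / ε := (one_le_div hε).2 hS.le
      linarith [Finset.single_le_sum (fun S _ => h0 S) (Finset.mem_univ S)]
  have hsum := Finset.sum_le_sum fun j (_ : j ∈ Finset.univ) => hpt j
  rw [Finset.sum_boole, Finset.sum_sub_distrib, Finset.sum_comm] at hsum
  simp only [← Finset.sum_div, Finset.sum_const, Finset.card_univ, Fintype.card_fin, nsmul_eq_mul,
    mul_one] at hsum
  rw [Nat.card_eq_fintype_card, Fintype.card_subtype, le_div_iff₀ hn']
  refine le_trans (le_of_eq ?_) hsum
  simp only [← Finset.sum_div, Fin.sum_univ_eq_sum_range]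
  field_simp

/-- Lemma: per-column polarization of all sub-entropies.
With `Y = X ⬝ G_n`, `X` having i.i.d. columns of law `μ` on `F₂^m`, the fraction of
column indices `j` such that for every `S ⊆ [m]` the conditional entropy
`H(Y_j[S] | Y^{j-1})` is within `ε` of an integer in `{0,…,|S|}` tends to `1`. -/
theorem statement2 (m : ℕ) (hm : 1 ≤ m)
    (ν : Measure (Fin m → ZMod 2)) [IsProbabilityMeasure ν]
    (Ω : ℕ → Type) [∀ k, MeasurableSpace (Ω k)] (μ : ∀ k, Measure (Ω k))
    (hprob : ∀ k, IsProbabilityMeasure (μ k))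
    (X : ∀ k, Ω k → Fin m → Fin (2 ^ k) → ZMod 2)
    (hmeas : ∀ k, Measurable (X k))
    (hiid : ∀ k, (μ k).map (fun ω => fun j i => X k ω i j)
      = Measure.pi fun _ : Fin (2 ^ k) => ν)
    (ε : ℝ) (hε : 0 < ε) :
    Tendsto (fun k : ℕ =>
        (Nat.card {j : Fin (2 ^ k) // ∀ S : Finset (Fin m), ∃ t : ℕ, t ≤ S.card ∧
            |cEnt (μ k) (fun ω (i : S) => (Matrix.of (X k ω) * G k) i.1 j)
                (fun ω (j' : Fin j.val) (r : Fin m) =>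
                  (Matrix.of (X k ω) * G k) r (j'.castLE j.isLt.le)) - (t : ℝ)| ≤ ε} : ℝ)
          / 2 ^ k)
      atTop (nhds 1) := by
  have hlim : ∀ S : Finset (Fin m), Tendsto (fun k => (∑ j ∈ Finset.range (2 ^ k),
      Metric.infDist (polarEnt (fun a => (ν {a}).toReal) (coordHom S) k j / Real.log 2)
        (natPoints S.card)) / 2 ^ k) atTop (nhds 0) := fun S =>
    tendsto_average_infDist_polarEnt (fun a => ENNReal.toReal_nonneg)
      (by simpa [Measure.real] using sum_measureReal_singleton (μ := ν) Finset.univ) (coordHom S)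
      (by simp)
  have hlow : Tendsto (fun k : ℕ => 1 - ∑ S : Finset (Fin m), ((∑ j ∈ Finset.range (2 ^ k),
      Metric.infDist (polarEnt (fun a => (ν {a}).toReal) (coordHom S) k j / Real.log 2)
        (natPoints S.card)) / 2 ^ k) / ε) atTop (nhds 1) := by
    simpa using (tendsto_finsetSum Finset.univ fun S _ => (hlim S).div_const ε).const_sub 1
  refine tendsto_of_tendsto_of_tendsto_of_le_of_le hlow tendsto_const_nhds (fun k => ?_)
    (fun k => ?_)
  · have h2 : ((2 ^ k : ℕ) : ℝ) = 2 ^ k := by push_cast; rfl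
    simp only [← h2]
    refine one_sub_le_card_div (by positivity) (fun S j => Metric.infDist_nonneg) hε
      fun j hj S => ?_
    obtain ⟨t, ht, hdist⟩ := exists_abs_sub_eq_infDist S.card
      (polarEnt (fun a => (ν {a}).toReal) (coordHom S) k j / Real.log 2)
    refine ⟨t, ht, ?_⟩
    rw [cEnt_mul_G_eq (hmeas k) (hiid k), hdist]
    exact hj S
  · refine div_le_one_of_le₀ ?_ (by positivity)
    calc _ ≤ (Nat.card (Fin (2 ^ k)) : ℝ) := by
          exact_mod_cast Nat.card_le_card_of_injective _ Subtype.val_injective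
      _ = 2 ^ k := by simp
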